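/- In the lattice 𝓛 of fully invariant congruences on F, the three elements σ_R := σ_RRδ ⊔ FIC{(xyx, yx²)}, σ_Rδ := σ_RRδ ⊔ FIC{(xyx, x²y)} and σ_DC := σ_RRδ ⊔ FIC{(x²y, yx²)} are pairwise distinct, any two of them have meet equal to σ_RRδ, and any two of them have join equal to σ_D ⊓ σ_C3; consequently the five elements σ_RRδ, σ_R, σ_Rδ, σ_DC, σ_D ⊓ σ_C3 form a diamond (a sublattice isomorphic to M₃), so the interval [σ_RRδ, ⊤] of 𝓛 is not distributive. -/

import Mathlib

/-- The free monoid on countably many generators. -/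
abbrev F : Type := FreeMonoid ℕ

/-- The fixed pairwise distinct generators. -/
def x : F := FreeMonoid.of 0
def y : F := FreeMonoid.of 1
def z : F := FreeMonoid.of 2
def t : F := FreeMonoid.of 3

/-- A congruence on `F` is fully invariant if it is stable under every
monoid endomorphism of `F`. -/
def IsFullyInvariant (c : Con F) : Prop :=
  ∀ ξ : F →* F, ∀ u v : F, c u v → c (ξ u) (ξ v)

/-- The type of fully invariant congruences on `F`. -/
abbrev FICon : Type := {c : Con F // IsFullyInvariant c}

instance : InfSet FICon :=
  ⟨fun S => ⟨sInf (Subtype.val '' S), fun ξ u v h c hc => by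
    obtain ⟨d, hd, rfl⟩ := hc
    exact d.2 ξ u v (h d.1 ⟨d, hd, rfl⟩)⟩⟩

/-- The complete lattice of fully invariant congruences on `F`:
meets are intersections, joins are the smallest fully invariant congruences
containing the union, `⊥` is the equality relation and `⊤` is the all relation. -/
noncomputable instance : CompleteLattice FICon :=
  completeLatticeOfInf FICon (fun S =>
    ⟨fun c hc => fun u v h => h c.1 ⟨c, hc, rfl⟩,
     fun c hc => fun u v h d hd => by
        obtain ⟨e, he, rfl⟩ := hd
        exact hc he h⟩)

/-- `fic S` is the smallest fully invariant congruence on `F` containing the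
set `S` of pairs of words. -/
noncomputable def fic (S : Set (F × F)) : FICon :=
  sInf {c : FICon | ∀ p ∈ S, c.1 p.1 p.2}

noncomputable def sigmaRR : FICon :=
  fic {(x ^ 4, x ^ 3), (x ^ 3 * y * z * t, y * x * z * x * t * x),
       (x * y * z * x * t * y, y * x * z * x * t * y),
       (x * z * x * y * t * y, x * z * y * x * t * y),
       (x * t * y * z * x * y, x * t * y * z * y * x)}

noncomputable def sigmaD : FICon :=
  fic {(x ^ 3, x ^ 2), (x ^ 2 * y, x * y * x), (x * y * x, y * x ^ 2)}

noncomputable def sigmaC3 : FICon := fic {(x ^ 4, x ^ 3), (x * y, y * x)}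

noncomputable def sigmaR : FICon := sigmaRR ⊔ fic {(x * y * x, y * x ^ 2)}

noncomputable def sigmaRdelta : FICon := sigmaRR ⊔ fic {(x * y * x, x ^ 2 * y)}

noncomputable def sigmaDC : FICon := sigmaRR ⊔ fic {(x ^ 2 * y, y * x ^ 2)}

theorem fic_le_iff {S : Set (F × F)} {c : FICon} :
    fic S ≤ c ↔ ∀ p ∈ S, c.1 p.1 p.2 := by
  constructor
  · intro h p hp
    refine h ?_
    rintro _ ⟨d, hd, rfl⟩
    exact hd p hp
  · exact fun h => sInf_le h

/-- The substitution sending the four fixed generators to the given words. -/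
def subst (X Y Z T : F) : F →* F :=
  FreeMonoid.lift fun n => if n = 0 then X else if n = 1 then Y else if n = 2 then Z else T

section subst
variable (X Y Z T : F)

@[simp] theorem subst_x : subst X Y Z T x = X := by simp [subst, x]
@[simp] theorem subst_y : subst X Y Z T y = Y := by simp [subst, y]
@[simp] theorem subst_z : subst X Y Z T z = Z := by simp [subst, z]
@[simp] theorem subst_t : subst X Y Z T t = T := by simp [subst, t]

end subst

/-- The fully invariant congruence of the syntactic monoid of the language `{w}`. -/
def synCon (w : F) : FICon :=
  ⟨{ r := fun u v => ∀ (ξ : F →* F) (p q : F), p * ξ u * q = w ↔ p * ξ v * q = w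
     iseqv := ⟨fun _ _ _ _ => Iff.rfl, fun h ξ p q => (h ξ p q).symm,
       fun h h' ξ p q => (h ξ p q).trans (h' ξ p q)⟩
     mul' := fun {a b a' b'} h h' ξ p q => by
       have h₁ := h ξ p (ξ a' * q)
       have h₂ := h' ξ (p * ξ b) q
       simp only [map_mul, mul_assoc] at h₁ h₂ ⊢
       exact h₁.trans h₂ },
   fun ξ _ _ h ξ' p q => h (ξ'.comp ξ) p q⟩

theorem synCon_iff {w u v : F} :
    (synCon w).1 u v ↔ ∀ (ξ : F →* F) (p q : F), p * ξ u * q = w ↔ p * ξ v * q = w :=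
  Iff.rfl

/-- The endomorphism deleting all letters other than `a` and `b`. -/
def keep (a b : ℕ) : F →* F :=
  FreeMonoid.lift fun n => if n = a ∨ n = b then FreeMonoid.of n else 1

theorem keep_ofList (a b : ℕ) (l : List ℕ) :
    keep a b (FreeMonoid.ofList l) =
      FreeMonoid.ofList (l.filter fun n => n = a ∨ n = b) := by
  induction l with
  | nil => rfl
  | cons c l ih =>
    rw [FreeMonoid.ofList_cons, map_mul, ih, List.filter_cons]
    by_cases h : c = a ∨ c = b <;> simp [keep, h, FreeMonoid.ofList_cons]

theorem filter_iff_of_synCon {l u v : List ℕ}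
    (h : (synCon (FreeMonoid.ofList l)).1 (FreeMonoid.ofList u) (FreeMonoid.ofList v))
    (a b : ℕ) :
    (u.filter fun n => n = a ∨ n = b) = l ↔ (v.filter fun n => n = a ∨ n = b) = l := by
  have := h (keep a b) 1 1
  simpa [keep_ofList] using this

/-! ### Soundness -/

/-- The number of occurrences of the letter `a` in a word. -/
def occ (a : ℕ) (u : F) : ℕ := u.toList.count a

@[simp] theorem occ_mul (a : ℕ) (u v : F) : occ a (u * v) = occ a u + occ a v := by
  simp [occ]

@[simp] theorem occ_pow (a : ℕ) (u : F) (n : ℕ) : occ a (u ^ n) = n * occ a u := by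
  induction n with
  | zero => simp [occ]
  | succ n ih => rw [pow_succ, occ_mul, ih]; ring

theorem eq_one_of_occ {u : F} (h : ∀ a, occ a u = 0) : u = 1 := by
  apply FreeMonoid.toList.injective
  exact List.eq_nil_iff_forall_not_mem.2 fun a ha => List.count_eq_zero.1 (h a) ha

theorem sigmaRR_le_synCon {w : F} (b : ℕ) (hw : ∀ a, occ a w ≤ 2)
    (hb : ∀ a, a ≠ b → occ a w ≤ 1) : sigmaRR ≤ synCon w := by
  have cube : ∀ {u X : F}, u = w → (∀ a, 3 * occ a X ≤ occ a u) → X = 1 := by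
    rintro u X rfl h
    exact eq_one_of_occ fun a => by have := h a; have := hw a; omega
  have two : ∀ {u X Y : F}, u = w → (∀ a, 2 * occ a X + 2 * occ a Y ≤ occ a u) →
      X = 1 ∨ Y = 1 := by
    rintro u X Y rfl h
    have aux : ∀ {X Y : F}, (∀ a, 2 * occ a X + 2 * occ a Y ≤ occ a u) → occ b X = 0 →
        X = 1 := fun h hX => eq_one_of_occ fun a => by
      by_cases hab : a = b
      · rwa [hab]
      · have := h a; have := hb a hab; omega
    by_cases hX : occ b X = 0
    · exact Or.inl (aux h hX)
    · refine Or.inr (aux (Y := X) (fun a => (add_comm _ _).trans_le (h a)) ?_)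
      have := h b; have := hw b; omega
  have key : ∀ {X : F} {A B : Prop}, (X = 1 → (A ↔ B)) → (A → X = 1) → (B → X = 1) → (A ↔ B) :=
    by tauto
  have key₂ : ∀ {X Y : F} {A B : Prop}, (X = 1 → (A ↔ B)) → (Y = 1 → (A ↔ B)) →
      (A → X = 1 ∨ Y = 1) → (B → X = 1 ∨ Y = 1) → (A ↔ B) := by tauto
  refine fic_le_iff.2 ?_
  simp only [Set.mem_insert_iff, Set.mem_singleton_iff, forall_eq_or_imp, forall_eq, synCon_iff,
    map_mul, map_pow]
  refine ⟨fun ξ p q => ?_, fun ξ p q => ?_, fun ξ p q => ?_, fun ξ p q => ?_, fun ξ p q => ?_⟩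
  iterate 2
    refine key (X := ξ x) (fun h => by simp [h]) (fun h => cube h fun a => ?_)
      (fun h => cube h fun a => ?_) <;> simp only [occ_mul, occ_pow] <;> omega
  all_goals
    refine key₂ (X := ξ x) (Y := ξ y) (fun h => by simp [h]) (fun h => by simp [h])
      (fun h => two h fun a => ?_) (fun h => two h fun a => ?_) <;>
      simp only [occ_mul] <;> omega

theorem occ_ofList (a : ℕ) (l : List ℕ) : occ a (FreeMonoid.ofList l) = l.count a := rfl

theorem eq_one_or_eq_of {l : List ℕ} {a b : ℕ} (hab : a ≠ b) (hl : l.Perm [a, a, b]) {X : F}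
    (h : ∀ c, 2 * occ c X ≤ l.count c) : X = 1 ∨ X = FreeMonoid.of a := by
  have ha : occ a X ≤ 1 := by
    have := h a
    simp only [hl.count_eq, List.count_cons, List.count_nil] at this
    simp [hab.symm] at this
    omega
  have hX : X.toList = List.replicate (occ a X) a := by
    refine (List.replicate_count_eq_of_count_eq_length (List.count_eq_length.2 fun c hc => ?_)).symm
    by_contra hca
    have h₁ : 0 < occ c X := List.count_pos_iff.2 hc
    have h₂ := h c
    rw [hl.count_eq, List.count_cons_of_ne hca, List.count_cons_of_ne hca] at h₂
    have h₃ : List.count c [b] ≤ 1 := List.count_le_length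
    omega
  interval_cases h : occ a X
  · exact Or.inl hX
  · exact Or.inr hX

theorem forall_of_singleton {P : List ℕ → List ℕ → List ℕ → Prop}
    (h₀ : ∀ p Y q, p.length + Y.length + q.length ≠ 1 → P p Y q) (h₁ : ∀ c, P [c] [] [])
    (h₂ : ∀ c, P [] [c] []) (h₃ : ∀ c, P [] [] [c]) (p Y q : List ℕ) : P p Y q := by
  by_cases h : p.length + Y.length + q.length = 1
  · obtain ⟨hp, hY, hq⟩ | ⟨hp, hY, hq⟩ | ⟨hp, hY, hq⟩ :
        (p.length = 1 ∧ Y.length = 0 ∧ q.length = 0) ∨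
        (p.length = 0 ∧ Y.length = 1 ∧ q.length = 0) ∨
        (p.length = 0 ∧ Y.length = 0 ∧ q.length = 1) := by omega
    all_goals
      simp only [List.length_eq_one_iff, List.length_eq_zero_iff] at hp hY hq
      grind
  · exact h₀ p Y q h

theorem middle_iff_right (a b : ℕ) : ∀ p Y q : List ℕ,
    p ++ (a :: (Y ++ a :: q)) = [a, a, b] ↔ p ++ (Y ++ (a :: a :: q)) = [a, a, b] := by
  apply forall_of_singleton
  · intro p Y q hl
    constructor <;> intro h <;> have := congrArg List.length h <;> simp at this <;> omega
  all_goals simp; try grind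

theorem middle_iff_left (a b : ℕ) : ∀ p Y q : List ℕ,
    p ++ (a :: (Y ++ a :: q)) = [b, a, a] ↔ p ++ (a :: a :: (Y ++ q)) = [b, a, a] := by
  apply forall_of_singleton
  · intro p Y q hl
    constructor <;> intro h <;> have := congrArg List.length h <;> simp at this <;> omega
  all_goals simp; try grind

theorem left_iff_right (a b : ℕ) : ∀ p Y q : List ℕ,
    p ++ (a :: a :: (Y ++ q)) = [a, b, a] ↔ p ++ (Y ++ (a :: a :: q)) = [a, b, a] := by
  apply forall_of_singleton
  · intro p Y q hl
    constructor <;> intro h <;> have := congrArg List.length h <;> simp at this <;> omega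
  all_goals simp; try grind

theorem sigmaRR_le_synCon_ofList {l : List ℕ} {a b : ℕ} (hab : a ≠ b) (hl : l.Perm [a, a, b]) :
    sigmaRR ≤ synCon (FreeMonoid.ofList l) := by
  refine sigmaRR_le_synCon a (fun c => ?_) fun c hc => ?_
  all_goals
    rw [occ_ofList, hl.count_eq]
    simp only [List.count_cons, List.count_nil, beq_iff_eq]
    split_ifs <;> omega

theorem iff_of_square {l : List ℕ} {a b : ℕ} (hab : a ≠ b) (hl : l.Perm [a, a, b])
    {X u v : F} (hu : ∀ c, 2 * occ c X ≤ occ c u) (hv : ∀ c, 2 * occ c X ≤ occ c v)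
    (h₁ : X = 1 → u = v)
    (h₂ : X = FreeMonoid.of a → (u = FreeMonoid.ofList l ↔ v = FreeMonoid.ofList l)) :
    u = FreeMonoid.ofList l ↔ v = FreeMonoid.ofList l := by
  have key : ∀ {w : F}, (∀ c, 2 * occ c X ≤ occ c w) → w = FreeMonoid.ofList l →
      X = 1 ∨ X = FreeMonoid.of a := by
    rintro _ h rfl
    exact eq_one_or_eq_of hab hl h
  constructor
  · intro h
    rcases key hu h with hX | hX
    · rwa [← h₁ hX]
    · exact (h₂ hX).1 h
  · intro h
    rcases key hv h with hX | hX
    · rwa [h₁ hX]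
    · exact (h₂ hX).2 h

theorem sigmaR_le_synCon {a b : ℕ} (hab : a ≠ b) :
    sigmaR ≤ synCon (FreeMonoid.ofList [a, a, b]) := by
  refine sup_le (sigmaRR_le_synCon_ofList hab (.refl _)) (fic_le_iff.2 ?_)
  rintro _ rfl ξ p q
  simp only [map_mul, map_pow]
  refine iff_of_square hab (.refl _) (X := ξ x) (fun c => ?_) (fun c => ?_)
    (fun h => by simp [h]) fun h => ?_
  · simp only [occ_mul]; omega
  · simp only [occ_mul, occ_pow]; omega
  · simp only [h, pow_two, mul_assoc]
    exact middle_iff_right a b p.toList (ξ y).toList q.toList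

theorem sigmaRdelta_le_synCon {a b : ℕ} (hab : a ≠ b) :
    sigmaRdelta ≤ synCon (FreeMonoid.ofList [b, a, a]) := by
  have hl : [b, a, a].Perm [a, a, b] := List.perm_append_comm (l₁ := [b]) (l₂ := [a, a])
  refine sup_le (sigmaRR_le_synCon_ofList hab hl) (fic_le_iff.2 ?_)
  rintro _ rfl ξ p q
  simp only [map_mul, map_pow]
  refine iff_of_square hab hl (X := ξ x) (fun c => ?_) (fun c => ?_)
    (fun h => by simp [h]) fun h => ?_
  · simp only [occ_mul]; omega
  · simp only [occ_mul, occ_pow]; omega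
  · simp only [h, pow_two, mul_assoc]
    exact middle_iff_left a b p.toList (ξ y).toList q.toList

theorem sigmaDC_le_synCon {a b : ℕ} (hab : a ≠ b) :
    sigmaDC ≤ synCon (FreeMonoid.ofList [a, b, a]) := by
  have hl : [a, b, a].Perm [a, a, b] := (List.Perm.swap a b []).cons a
  refine sup_le (sigmaRR_le_synCon_ofList hab hl) (fic_le_iff.2 ?_)
  rintro _ rfl ξ p q
  simp only [map_mul, map_pow]
  refine iff_of_square hab hl (X := ξ x) (fun c => ?_) (fun c => ?_)
    (fun h => by simp [h]) fun h => ?_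
  · simp only [occ_mul, occ_pow]; omega
  · simp only [occ_mul, occ_pow]; omega
  · simp only [h, pow_two, mul_assoc]
    exact left_iff_right a b p.toList (ξ y).toList q.toList

theorem sigmaD_le_synCon {w : F} (hw : ∀ a, occ a w ≤ 1) : sigmaD ≤ synCon w := by
  have key : ∀ {X u v : F}, (∀ a, 2 * occ a X ≤ occ a u) → (∀ a, 2 * occ a X ≤ occ a v) →
      (X = 1 → u = v) → (u = w ↔ v = w) := by
    intro X u v hu hv h
    have one : ∀ {u : F}, u = w → (∀ a, 2 * occ a X ≤ occ a u) → X = 1 := by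
      rintro _ rfl h
      exact eq_one_of_occ fun a => by have := h a; have := hw a; omega
    constructor
    · intro h'
      rwa [← h (one h' hu)]
    · intro h'
      rwa [h (one h' hv)]
  refine fic_le_iff.2 ?_
  simp only [Set.mem_insert_iff, Set.mem_singleton_iff, forall_eq_or_imp, forall_eq, synCon_iff,
    map_mul, map_pow]
  refine ⟨fun ξ p q => ?_, fun ξ p q => ?_, fun ξ p q => ?_⟩
  all_goals
    refine key (X := ξ x) (fun a => ?_) (fun a => ?_) (fun h => by simp [h]) <;>
      simp only [occ_mul, occ_pow] <;> omega

theorem sigmaC3_le_synCon (a : ℕ) {k : ℕ} (hk : k ≤ 2) :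
    sigmaC3 ≤ synCon (FreeMonoid.ofList (List.replicate k a)) := by
  have hw : ∀ c, occ c (FreeMonoid.ofList (List.replicate k a)) ≤ 2 := fun c => by
    rw [occ_ofList, List.count_replicate]
    split_ifs <;> omega
  refine fic_le_iff.2 ?_
  simp only [Set.mem_insert_iff, Set.mem_singleton_iff, forall_eq_or_imp, forall_eq, synCon_iff,
    map_mul, map_pow]
  refine ⟨fun ξ p q => ?_, fun ξ p q => ?_⟩
  · have key : ∀ n ≥ 3, p * ξ x ^ n * q = FreeMonoid.ofList (List.replicate k a) → ξ x = 1 :=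
      fun n hn h => eq_one_of_occ fun c => by
        have := hw c
        rw [← h] at this
        simp only [occ_mul, occ_pow] at this
        nlinarith
    constructor
    · intro h
      simpa [key 4 (by norm_num) h] using h
    · intro h
      simpa [key 3 le_rfl h] using h
  · have hp : (p * (ξ x * ξ y) * q).toList.Perm (p * (ξ y * ξ x) * q).toList := by
      simpa using (List.perm_append_comm.append_left p.toList).append_right q.toList
    have : ∀ {u v : F}, u.toList.Perm v.toList →
        u = FreeMonoid.ofList (List.replicate k a) → v = FreeMonoid.ofList (List.replicate k a) := by
      rintro _ v h rfl
      exact FreeMonoid.toList.injective (List.perm_replicate.1 h.symm)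
    exact ⟨this hp, this hp.symm⟩

/-! ### Completeness -/

/-- Erasing all letters other than `a` and `b`. -/
abbrev proj (a b : ℕ) (l : List ℕ) : List ℕ := l.filter fun n => n = a ∨ n = b

theorem proj_comm (a b : ℕ) (l : List ℕ) : proj a b l = proj b a l := by
  simp only [proj, or_comm]

/-- A word over a partially commutative alphabet is determined up to commutations by its
projections to pairs of letters that do not commute. -/
theorem Con.of_proj_eq (c : Con F) (I : ℕ → ℕ → Prop) (hI : ∀ a b, I a b → I b a) (w : List ℕ)
    (swap : ∀ p q a b, I a b → a ≠ b → (p ++ a :: b :: q).Perm w →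
      c (FreeMonoid.ofList (p ++ a :: b :: q)) (FreeMonoid.ofList (p ++ b :: a :: q))) :
    ∀ p u v : List ℕ, (p ++ u).Perm w → u.Perm v →
      (∀ a b, a ≠ b → ¬ I a b → proj a b u = proj a b v) →
      c (FreeMonoid.ofList (p ++ u)) (FreeMonoid.ofList (p ++ v)) := by
  have shift : ∀ b (l p q : List ℕ), (∀ d ∈ l, I d b ∧ d ≠ b) → (p ++ (l ++ b :: q)).Perm w →
      c (FreeMonoid.ofList (p ++ (l ++ b :: q))) (FreeMonoid.ofList (p ++ b :: (l ++ q))) := by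
    intro b l
    induction l with
    | nil => exact fun p q _ _ => c.refl _
    | cons d l ih =>
      intro p q hl hw
      have h₁ := ih (p ++ [d]) q (fun e he => hl e (List.mem_cons_of_mem _ he))
        (by simpa using hw)
      have h₂ := swap p (l ++ q) d b (hl d List.mem_cons_self).1 (hl d List.mem_cons_self).2
        (.trans (by simpa using (List.perm_middle.symm.cons d).append_left p) hw)
      simp only [List.append_assoc, List.cons_append, List.nil_append] at h₁ ⊢
      exact c.trans h₁ h₂
  intro p u
  induction u generalizing p with
  | nil =>
    intro v _ huv _
    rw [huv.nil_eq]
    exact c.refl _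
  | cons b u ih =>
    intro v hw huv hproj
    obtain ⟨v₁, v₂, rfl, hb⟩ := List.eq_append_cons_of_mem (huv.subset List.mem_cons_self)
    have hv₁ : ∀ d ∈ v₁, I d b ∧ d ≠ b := by
      intro d hd
      have hdb : d ≠ b := by rintro rfl; exact hb hd
      refine ⟨?_, hdb⟩
      by_contra hI'
      have h := hproj d b hdb hI'
      obtain ⟨s, r, rfl, hs⟩ := List.eq_append_cons_of_mem hd
      have hs' : proj d b s = [] := by
        rw [proj, List.filter_eq_nil_iff]
        intro e he
        simp only [decide_eq_true_eq, not_or]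
        exact ⟨by rintro rfl; exact hs he, by rintro rfl; exact hb (by simp [he])⟩
      simp only [proj, Bool.decide_or, List.filter_append] at h hs'
      simp [hs'] at h
      exact hdb h.1.symm
    have huv' : u.Perm (v₁ ++ v₂) := (huv.trans List.perm_middle).cons_inv
    have hrec := ih (p ++ [b]) (v₁ ++ v₂) (by simpa using hw) huv' fun e f hef hIef => by
      have h := hproj e f hef hIef
      by_cases hbe : b = e ∨ b = f
      · have hv : proj e f v₁ = [] := by
          rw [proj, List.filter_eq_nil_iff]
          intro d hd
          simp only [decide_eq_true_eq, not_or]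
          have hd' := hv₁ d hd
          rcases hbe with rfl | rfl
          · exact ⟨hd'.2, by rintro rfl; exact hIef (hI _ _ hd'.1)⟩
          · exact ⟨by rintro rfl; exact hIef hd'.1, hd'.2⟩
        simp only [proj, Bool.decide_or, List.filter_append] at h hv ⊢
        simpa [hv, hbe] using h
      · simpa [proj, List.filter_cons, hbe] using h
    have hvw : (p ++ (v₁ ++ b :: v₂)).Perm w := (huv.symm.append_left p).trans hw
    simp only [List.append_assoc, List.cons_append, List.nil_append] at hrec
    exact c.trans hrec (c.symm (shift b v₁ p v₂ hv₁ hvw))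

section RR
variable {c : FICon}

theorem cube_central (hc : sigmaRR ≤ c) (X Y Z T : F) :
    c.1 (X ^ 3 * Y * Z * T) (Y * X * Z * X * T * X) := by
  have h := c.2 (subst X Y Z T) _ _ (fic_le_iff.1 hc (x ^ 3 * y * z * t, y * x * z * x * t * x)
    (by simp))
  simp only [map_mul, map_pow, subst_x, subst_y, subst_z, subst_t] at h
  exact h

theorem pow_four (hc : sigmaRR ≤ c) (X : F) : c.1 (X ^ 4) (X ^ 3) := by
  have h := c.2 (subst X 1 1 1) _ _ (fic_le_iff.1 hc (x ^ 4, x ^ 3) (by simp))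
  simp only [map_pow, subst_x] at h
  exact h

theorem swap_first_first (hc : sigmaRR ≤ c) (X Y Z T : F) :
    c.1 (X * Y * Z * X * T * Y) (Y * X * Z * X * T * Y) := by
  simpa using c.2 (subst X Y Z T) _ _ (fic_le_iff.1 hc
    (x * y * z * x * t * y, y * x * z * x * t * y) (by simp))

theorem swap_second_first (hc : sigmaRR ≤ c) (X Y Z T : F) :
    c.1 (X * Z * X * Y * T * Y) (X * Z * Y * X * T * Y) := by
  simpa using c.2 (subst X Y Z T) _ _ (fic_le_iff.1 hc
    (x * z * x * y * t * y, x * z * y * x * t * y) (by simp))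

theorem swap_second_second (hc : sigmaRR ≤ c) (X Y Z T : F) :
    c.1 (X * T * Y * Z * X * Y) (X * T * Y * Z * Y * X) := by
  simpa using c.2 (subst X Y Z T) _ _ (fic_le_iff.1 hc
    (x * t * y * z * x * y, x * t * y * z * y * x) (by simp))

theorem cube_mul_filter (hc : sigmaRR ≤ c) (a : ℕ) (w : List ℕ) :
    c.1 (FreeMonoid.of a ^ 3 * FreeMonoid.ofList w)
      (FreeMonoid.of a ^ 3 * FreeMonoid.ofList (w.filter (· ≠ a))) := by
  induction w with
  | nil => exact c.1.refl _
  | cons b w ih =>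
    by_cases hb : b = a
    · subst hb
      have h := c.1.mul (pow_four hc (FreeMonoid.of b)) (c.1.refl (FreeMonoid.ofList w))
      simp only [FreeMonoid.ofList_cons, ne_eq, not_true_eq_false, decide_false,
        Bool.false_eq_true, not_false_eq_true, List.filter_cons_of_neg]
      rw [pow_succ, mul_assoc] at h
      exact c.1.trans h ih
    · have central := cube_central hc (FreeMonoid.of a) (FreeMonoid.of b) 1 1
      simp only [mul_one, mul_assoc] at central
      have h₁ := c.1.mul central (c.1.refl (FreeMonoid.ofList w))
      have h₂ := c.1.mul central (c.1.refl (FreeMonoid.ofList (w.filter (· ≠ a))))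
      have h₃ := c.1.mul (c.1.refl (FreeMonoid.of b)) ih
      simp only [pow_succ, pow_zero, one_mul, mul_assoc] at h₁ h₂ h₃ ⊢
      simp only [FreeMonoid.ofList_cons, ne_eq, hb, not_false_eq_true, decide_true,
        List.filter_cons_of_pos]
      exact c.1.trans h₁ (c.1.trans h₃ (c.1.symm h₂))

theorem cube_filter (hc : sigmaRR ≤ c) {a : ℕ} {w : List ℕ} (h : 3 ≤ w.count a) :
    c.1 (FreeMonoid.ofList w)
      (FreeMonoid.of a ^ 3 * FreeMonoid.ofList (w.filter (· ≠ a))) := by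
  obtain ⟨p, w₁, rfl, hp⟩ :=
    List.eq_append_cons_of_mem (List.count_pos_iff.1 (by omega : 0 < w.count a))
  rw [List.count_append, List.count_eq_zero.2 hp, List.count_cons_self] at h
  obtain ⟨q, w₂, rfl, hq⟩ :=
    List.eq_append_cons_of_mem (List.count_pos_iff.1 (by omega : 0 < w₁.count a))
  rw [List.count_append, List.count_eq_zero.2 hq, List.count_cons_self] at h
  obtain ⟨r, s, rfl⟩ := List.append_of_mem (List.count_pos_iff.1 (by omega : 0 < w₂.count a))
  have h₁ := c.1.mul (c.1.symm (cube_central hc (FreeMonoid.of a) (FreeMonoid.ofList p)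
    (FreeMonoid.ofList q) (FreeMonoid.ofList r))) (c.1.refl (FreeMonoid.ofList s))
  have h₂ := cube_mul_filter hc a (p ++ (q ++ (r ++ s)))
  have h₃ : (p ++ a :: (q ++ a :: (r ++ a :: s))).filter (· ≠ a) =
      (p ++ (q ++ (r ++ s))).filter (· ≠ a) := by simp
  rw [h₃]
  simp only [FreeMonoid.ofList_append, FreeMonoid.ofList_cons, mul_assoc] at h₁ h₂ ⊢
  exact c.1.trans h₁ h₂

theorem con_of_proj_eq (hc : sigmaRR ≤ c) {S : ℕ → ℕ → Prop} (hS : ∀ m n, S m n → S n m)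
    (swap : ∀ p q a b, a ≠ b →
      S ((p ++ a :: b :: q).count a) ((p ++ a :: b :: q).count b) →
      c.1 (FreeMonoid.ofList (p ++ a :: b :: q)) (FreeMonoid.ofList (p ++ b :: a :: q)))
    (u v : List ℕ) (hcount : ∀ a, ∀ k ≤ 2, u.count a = k ↔ v.count a = k)
    (hproj : ∀ a b, a ≠ b → u.count a ≤ 2 → u.count b ≤ 2 → ¬ S (u.count a) (u.count b) →
      proj a b u = proj a b v) :
    c.1 (FreeMonoid.ofList u) (FreeMonoid.ofList v) := by
  induction hn : u.length using Nat.strong_induction_on generalizing u v with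
  | _ n ih =>
  subst hn
  by_cases h : ∃ a, 3 ≤ u.count a
  · obtain ⟨a, ha⟩ := h
    have ha' : 3 ≤ v.count a := by
      by_contra h
      have := (hcount a (v.count a) (by omega)).2 rfl
      omega
    have hlt : (u.filter (· ≠ a)).length < u.length := by
      rw [List.length_filter_lt_length_iff_exists]
      exact ⟨a, List.count_pos_iff.1 (by omega), by simp⟩
    have count_ne : ∀ l : List ℕ, ∀ b ≠ a, (l.filter (· ≠ a)).count b = l.count b :=
      fun l b hb => List.count_filter (by simpa using hb)
    have count_self : ∀ l : List ℕ, (l.filter (· ≠ a)).count a = 0 :=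
      fun l => List.count_eq_zero.2 (by simp)
    have proj_self : ∀ (l : List ℕ) (d : ℕ), d ≠ a →
        proj a d (l.filter (· ≠ a)) = List.replicate (l.count d) d := fun l d hd => by
      rw [← List.filter_beq, proj, List.filter_filter]
      refine List.filter_congr fun e _ => ?_
      grind
    have proj_ne : ∀ (l : List ℕ) (b d : ℕ), b ≠ a → d ≠ a →
        proj b d (l.filter (· ≠ a)) = proj b d l := fun l b d hb hd => by
      rw [proj, List.filter_filter]
      refine List.filter_congr fun e _ => ?_
      grind
    have hrec := ih _ hlt (u.filter (· ≠ a)) (v.filter (· ≠ a))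
      (fun b k hk => by
        by_cases hb : b = a
        · rw [hb, count_self, count_self]
        · rw [count_ne _ _ hb, count_ne _ _ hb]
          exact hcount b k hk)
      (fun b d hbd hb hd hbdS => by
        by_cases hba : b = a
        · subst hba
          rw [count_ne _ _ hbd.symm] at hd
          rw [proj_self _ _ hbd.symm, proj_self _ _ hbd.symm, (hcount d _ hd).1 rfl]
        by_cases hda : d = a
        · subst hda
          rw [count_ne _ _ hbd] at hb
          rw [proj_comm, proj_self _ _ hbd, proj_comm, proj_self _ _ hbd, (hcount b _ hb).1 rfl]
        · rw [count_ne _ _ hba] at hb hbdS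
          rw [count_ne _ _ hda] at hd hbdS
          rw [proj_ne _ _ _ hba hda, proj_ne _ _ _ hba hda]
          exact hproj b d hbd hb hd hbdS) rfl
    exact c.1.trans (cube_filter hc ha)
      (c.1.trans (c.1.mul (c.1.refl _) hrec) (c.1.symm (cube_filter hc ha')))
  · push Not at h
    have hperm : u.Perm v := List.perm_iff_count.2 fun a =>
      ((hcount a (u.count a) (by have := h a; omega)).1 rfl).symm
    refine Con.of_proj_eq c.1 (fun a b => S (u.count a) (u.count b)) (fun _ _ => hS _ _) u
      (fun p q a b hI hab hw => ?_) [] u v (.refl _) hperm fun a b hab hI => ?_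
    · exact swap p q a b hab (by rwa [hw.count_eq, hw.count_eq])
    · exact hproj a b hab (by have := h a; omega) (by have := h b; omega) hI

end RR

theorem swap_of_two_le {c : FICon} (hc : sigmaRR ≤ c) {p q : List ℕ} {a b : ℕ} (hab : a ≠ b)
    (ha : 2 ≤ (p ++ a :: b :: q).count a) (hb : 2 ≤ (p ++ a :: b :: q).count b) :
    c.1 (FreeMonoid.ofList (p ++ a :: b :: q)) (FreeMonoid.ofList (p ++ b :: a :: q)) := by
  have ha' : a ∈ p ∨ a ∈ q := by
    simp only [← List.count_pos_iff]
    simp [hab.symm] at ha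
    omega
  have hb' : b ∈ p ∨ b ∈ q := by
    simp only [← List.count_pos_iff]
    simp [hab] at hb
    omega
  have ctx : ∀ {u v : F} (r s : List ℕ), c.1 u v →
      c.1 (FreeMonoid.ofList r * u * FreeMonoid.ofList s)
        (FreeMonoid.ofList r * v * FreeMonoid.ofList s) :=
    fun r s h => c.1.mul (c.1.mul (c.1.refl _) h) (c.1.refl _)
  have both : ∀ {a b : ℕ} {l : List ℕ}, a ≠ b → a ∈ l → b ∈ l →
      (∃ r s w, l = r ++ a :: s ++ b :: w) ∨ (∃ r s w, l = r ++ b :: s ++ a :: w) := by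
    intro a b l hab ha hb
    obtain ⟨r, s, rfl⟩ := List.append_of_mem ha
    rcases List.mem_append.1 hb with hb | hb
    · obtain ⟨r, t, rfl⟩ := List.append_of_mem hb
      exact Or.inr ⟨r, t, s, rfl⟩
    · obtain ⟨s, t, rfl⟩ := List.append_of_mem (List.mem_of_ne_of_mem hab.symm hb)
      exact Or.inl ⟨r, s, t, by simp⟩
  rcases ha' with ha' | ha' <;> rcases hb' with hb' | hb'
  · obtain ⟨r, s, w, rfl⟩ | ⟨r, s, w, rfl⟩ := both hab ha' hb'
    · have h := ctx r q (swap_second_second hc (FreeMonoid.of a) (FreeMonoid.of b)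
        (FreeMonoid.ofList w) (FreeMonoid.ofList s))
      simpa [FreeMonoid.ofList_append, FreeMonoid.ofList_cons, mul_assoc] using h
    · have h := c.1.symm (ctx r q (swap_second_second hc (FreeMonoid.of b) (FreeMonoid.of a)
        (FreeMonoid.ofList w) (FreeMonoid.ofList s)))
      simpa [FreeMonoid.ofList_append, FreeMonoid.ofList_cons, mul_assoc] using h
  · obtain ⟨r, s, rfl⟩ := List.append_of_mem ha'
    obtain ⟨w, q, rfl⟩ := List.append_of_mem hb'
    have h := ctx r q (swap_second_first hc (FreeMonoid.of a) (FreeMonoid.of b)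
        (FreeMonoid.ofList s) (FreeMonoid.ofList w))
    simpa [FreeMonoid.ofList_append, FreeMonoid.ofList_cons, mul_assoc] using h
  · obtain ⟨r, s, rfl⟩ := List.append_of_mem hb'
    obtain ⟨w, q, rfl⟩ := List.append_of_mem ha'
    have h := c.1.symm (ctx r q (swap_second_first hc (FreeMonoid.of b) (FreeMonoid.of a)
        (FreeMonoid.ofList s) (FreeMonoid.ofList w)))
    simpa [FreeMonoid.ofList_append, FreeMonoid.ofList_cons, mul_assoc] using h
  · obtain ⟨r, s, w, rfl⟩ | ⟨r, s, w, rfl⟩ := both hab ha' hb'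
    · have h := ctx p w (swap_first_first hc (FreeMonoid.of a) (FreeMonoid.of b)
        (FreeMonoid.ofList r) (FreeMonoid.ofList s))
      simpa [FreeMonoid.ofList_append, FreeMonoid.ofList_cons, mul_assoc] using h
    · have h := c.1.symm (ctx p w (swap_first_first hc (FreeMonoid.of b) (FreeMonoid.of a)
        (FreeMonoid.ofList r) (FreeMonoid.ofList s)))
      simpa [FreeMonoid.ofList_append, FreeMonoid.ofList_cons, mul_assoc] using h

/-- If squares are central and `xyx = x²y`, then a letter occurring twice commutes with its
neighbours. -/
theorem swap_of_two_le_left {c : FICon} (h₁ : ∀ X Y : F, c.1 (X * Y * X) (X ^ 2 * Y))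
    (h₂ : ∀ X Y : F, c.1 (X * Y * X) (Y * X ^ 2)) {p q : List ℕ} {a b : ℕ} (hab : a ≠ b)
    (ha : 2 ≤ (p ++ a :: b :: q).count a) :
    c.1 (FreeMonoid.ofList (p ++ a :: b :: q)) (FreeMonoid.ofList (p ++ b :: a :: q)) := by
  have ha' : a ∈ p ∨ a ∈ q := by
    simp only [← List.count_pos_iff]
    simp [hab.symm] at ha
    omega
  have ctx : ∀ {u v : F} (r s : List ℕ), c.1 u v →
      c.1 (FreeMonoid.ofList r * u * FreeMonoid.ofList s)
        (FreeMonoid.ofList r * v * FreeMonoid.ofList s) :=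
    fun r s h => c.1.mul (c.1.mul (c.1.refl _) h) (c.1.refl _)
  rcases ha' with ha' | ha'
  · obtain ⟨r, s, rfl⟩ := List.append_of_mem ha'
    have h := c.1.trans
      (c.1.mul (h₁ (FreeMonoid.of a) (FreeMonoid.ofList s)) (c.1.refl (FreeMonoid.of b)))
      (c.1.symm ((mul_assoc (FreeMonoid.of a ^ 2) _ _).symm ▸
        h₁ (FreeMonoid.of a) (FreeMonoid.ofList s * FreeMonoid.of b)))
    have h := ctx r q h
    simpa [FreeMonoid.ofList_append, FreeMonoid.ofList_cons, mul_assoc] using h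
  · obtain ⟨s, w, rfl⟩ := List.append_of_mem ha'
    have h := c.1.trans
      (h₂ (FreeMonoid.of a) (FreeMonoid.of b * FreeMonoid.ofList s))
      (c.1.symm ((mul_assoc (FreeMonoid.of b) _ (FreeMonoid.of a ^ 2)) ▸ c.1.mul
        (c.1.refl (FreeMonoid.of b)) (h₂ (FreeMonoid.of a) (FreeMonoid.ofList s))))
    have h := ctx p w h
    simpa [FreeMonoid.ofList_append, FreeMonoid.ofList_cons, mul_assoc] using h

theorem proj_perm {a b : ℕ} (hab : a ≠ b) (l : List ℕ) :
    (proj a b l).Perm (List.replicate (l.count a) a ++ List.replicate (l.count b) b) := by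
  refine List.perm_iff_count.2 fun c => ?_
  rw [List.count_append, List.count_replicate, List.count_replicate]
  by_cases hc : c = a ∨ c = b
  · rw [List.count_filter (by simpa using hc)]
    grind
  · rw [List.count_eq_zero.2 (by simp [hc])]
    grind

theorem proj_eq_of_count_eq_zero {u v : List ℕ}
    (hcount : ∀ a, ∀ k ≤ 2, u.count a = k ↔ v.count a = k) {a b : ℕ} (hab : a ≠ b)
    (ha : u.count a = 0) (hb : u.count b ≤ 2) : proj a b u = proj a b v := by
  have hu := proj_perm hab u
  have hv := proj_perm hab v
  rw [(hcount b _ hb).1 rfl, (hcount a 0 (by norm_num)).1 ha] at hv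
  rw [ha] at hu
  simp only [List.replicate_zero, List.nil_append, List.perm_replicate] at hu hv
  rw [hu, hv]

theorem count_iff_of_sigmaC3 {u v : List ℕ}
    (h : sigmaC3.1 (FreeMonoid.ofList u) (FreeMonoid.ofList v)) (a k : ℕ) (hk : k ≤ 2) :
    u.count a = k ↔ v.count a = k := by
  have := filter_iff_of_synCon (sigmaC3_le_synCon a hk h) a a
  simpa [List.filter_eq, List.replicate_inj] using this

theorem proj_eq_of_sigmaD {u v : List ℕ}
    (h : sigmaD.1 (FreeMonoid.ofList u) (FreeMonoid.ofList v)) {a b : ℕ} (hab : a ≠ b)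
    (hua : u.count a = 1) (hub : u.count b = 1) (hva : v.count a = 1) (hvb : v.count b = 1) :
    proj a b u = proj a b v := by
  have hu := proj_perm hab u
  have hv := proj_perm hab v
  have key := filter_iff_of_synCon (sigmaD_le_synCon (w := FreeMonoid.ofList [a, b])
    (fun c => by
      rw [occ_ofList]
      simp only [List.count_cons, List.count_nil, beq_iff_eq]
      split_ifs <;> omega) h) a b
  have pair : ∀ {l : List ℕ}, l.Perm [a, b] → l = [a, b] ∨ l = [b, a] := by
    intro l hl
    obtain ⟨c, d, rfl⟩ := List.length_eq_two.1 hl.length_eq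
    have := hl.count_eq a
    have hba := hab.symm
    have hc : c = a ∨ c = b := by simpa using hl.subset (a := c) (by simp)
    have hd : d = a ∨ d = b := by simpa using hl.subset (a := d) (by simp)
    rcases hc with rfl | rfl <;> rcases hd with rfl | rfl <;> simp_all
  rw [hua, hub] at hu
  rw [hva, hvb] at hv
  rcases pair hu with hu | hu
  · exact hu.trans (key.1 hu).symm
  · rcases pair hv with hv | hv
    · exact (key.2 hv).trans hv.symm
    · exact hu.trans hv.symm

theorem eq_of_perm_triple {a b : ℕ} (hab : a ≠ b) {l : List ℕ} (hl : l.Perm [a, a, b]) :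
    l = [a, a, b] ∨ l = [a, b, a] ∨ l = [b, a, a] := by
  obtain ⟨c, d, e, rfl⟩ := List.length_eq_three.1 hl.length_eq
  have := hl.count_eq a
  have hba := hab.symm
  have hc : c = a ∨ c = b := by simpa using hl.subset (a := c) (by simp)
  have hd : d = a ∨ d = b := by simpa using hl.subset (a := d) (by simp)
  have he : e = a ∨ e = b := by simpa using hl.subset (a := e) (by simp)
  rcases hc with rfl | rfl <;> rcases hd with rfl | rfl <;> rcases he with rfl | rfl <;>
    simp_all

theorem le_sigmaRR {c : FICon} (hc : c ≤ sigmaD ⊓ sigmaC3)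
    (h : ∀ (a b : ℕ) (u v : List ℕ), a ≠ b →
      c.1 (FreeMonoid.ofList u) (FreeMonoid.ofList v) →
      (proj a b u).Perm [a, a, b] → (proj a b v).Perm [a, a, b] → proj a b u = proj a b v) :
    c ≤ sigmaRR := by
  rintro (u : List ℕ) (v : List ℕ) huv
  have hD := (hc.trans inf_le_left) huv
  have hcount := count_iff_of_sigmaC3 ((hc.trans inf_le_right) huv)
  have triple : ∀ {a b : ℕ}, a ≠ b → List.count a u = 2 → List.count b u = 1 →
      proj a b u = proj a b v := by
    intro a b hab ha hb
    have hu := proj_perm hab u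
    have hv := proj_perm hab v
    rw [ha, hb] at hu
    rw [(hcount a 2 le_rfl).1 ha, (hcount b 1 (by norm_num)).1 hb] at hv
    exact h a b u v hab huv hu hv
  refine con_of_proj_eq le_rfl (S := fun m n => 2 ≤ m ∧ 2 ≤ n) (fun _ _ h => h.symm)
    (fun p q a b hab h => swap_of_two_le le_rfl hab h.1 h.2) u v hcount fun a b hab ha hb hS => ?_
  by_cases ha₀ : List.count a u = 0
  · exact proj_eq_of_count_eq_zero hcount hab ha₀ hb
  by_cases hb₀ : List.count b u = 0
  · rw [proj_comm, proj_eq_of_count_eq_zero hcount hab.symm hb₀ ha, proj_comm]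
  by_cases ha₂ : List.count a u = 2
  · exact triple hab ha₂ (by omega)
  by_cases hb₂ : List.count b u = 2
  · rw [proj_comm, triple hab.symm hb₂ (by omega), proj_comm]
  have ha₁ : List.count a u = 1 := by omega
  have hb₁ : List.count b u = 1 := by omega
  exact proj_eq_of_sigmaD hD hab ha₁ hb₁ ((hcount a 1 (by norm_num)).1 ha₁)
    ((hcount b 1 (by norm_num)).1 hb₁)

theorem sigmaD_inf_sigmaC3_le {c : FICon} (hc : sigmaRR ≤ c)
    (h₁ : c.1 (x * y * x) (x ^ 2 * y)) (h₂ : c.1 (x * y * x) (y * x ^ 2)) :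
    sigmaD ⊓ sigmaC3 ≤ c := by
  rintro (u : List ℕ) (v : List ℕ) huv
  have hD := (inf_le_left : sigmaD ⊓ sigmaC3 ≤ sigmaD) huv
  have hcount := count_iff_of_sigmaC3 ((inf_le_right : sigmaD ⊓ sigmaC3 ≤ sigmaC3) huv)
  have h₁' : ∀ X Y : F, c.1 (X * Y * X) (X ^ 2 * Y) := fun X Y => by
    have := c.2 (subst X Y 1 1) _ _ h₁
    simpa only [map_mul, map_pow, subst_x, subst_y] using this
  have h₂' : ∀ X Y : F, c.1 (X * Y * X) (Y * X ^ 2) := fun X Y => by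
    have := c.2 (subst X Y 1 1) _ _ h₂
    simpa only [map_mul, map_pow, subst_x, subst_y] using this
  refine con_of_proj_eq hc (S := fun m n => 2 ≤ m ∨ 2 ≤ n) (fun _ _ h => h.symm)
    (fun p q a b hab h => ?_) u v hcount fun a b hab ha hb hS => ?_
  · rcases h with h | h
    · exact swap_of_two_le_left h₁' h₂' hab h
    · refine c.1.symm (swap_of_two_le_left h₁' h₂' hab.symm ?_)
      rwa [((List.Perm.swap a b q).append_left p).symm.count_eq] at h
  by_cases ha₀ : List.count a u = 0
  · exact proj_eq_of_count_eq_zero hcount hab ha₀ hb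
  by_cases hb₀ : List.count b u = 0
  · rw [proj_comm, proj_eq_of_count_eq_zero hcount hab.symm hb₀ ha, proj_comm]
  have ha₁ : List.count a u = 1 := by omega
  have hb₁ : List.count b u = 1 := by omega
  exact proj_eq_of_sigmaD hD hab ha₁ hb₁ ((hcount a 1 (by norm_num)).1 ha₁)
    ((hcount b 1 (by norm_num)).1 hb₁)

/-! ### The diamond -/

/-- The identities of `sigmaRR` hold in every monoid with central squares and `xyx = x²y`. -/
theorem identities_of_sq {M : Type*} [Monoid M] (h₁ : ∀ a : M, a ^ 3 = a ^ 2)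
    (h₂ : ∀ a b : M, a ^ 2 * b = a * b * a) (h₃ : ∀ a b : M, a * b * a = b * a ^ 2)
    (a b c d : M) :
    a ^ 4 = a ^ 3 ∧ a ^ 3 * b * c * d = b * a * c * a * d * a ∧
      a * b * c * a * d * b = b * a * c * a * d * b ∧
      a * c * a * b * d * b = a * c * b * a * d * b ∧
      a * d * b * c * a * b = a * d * b * c * b * a := by
  have h₄ : ∀ a b : M, b * a ^ 2 = a ^ 2 * b := fun a b => ((h₂ a b).trans (h₃ a b)).symm
  refine ⟨?_, ?_, ?_, ?_, ?_⟩
  · rw [pow_succ, h₁, ← pow_succ, h₁]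
  · calc a ^ 3 * b * c * d = a ^ 2 * (b * c * d) := by rw [h₁]; simp only [mul_assoc]
      _ = a ^ 3 * (b * c * d) := by rw [h₁]
      _ = a * (a ^ 2 * b) * (c * d) := by simp only [pow_succ, pow_zero, one_mul, mul_assoc]
      _ = a * b * a * a * (c * d) := by
        rw [← h₄]; simp only [pow_succ, pow_zero, one_mul, mul_assoc]
      _ = b * a ^ 3 * (c * d) := by
        rw [h₃]; simp only [pow_succ, pow_zero, one_mul, mul_assoc]
      _ = b * (a ^ 2 * (c * d)) := by rw [h₁]; simp only [mul_assoc]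
      _ = b * (a ^ 3 * (c * d)) := by rw [h₁]
      _ = b * (a * (a ^ 2 * (c * d))) := by simp only [pow_succ, pow_zero, one_mul, mul_assoc]
      _ = b * (a ^ 2 * c * d * a) := by
        rw [h₂]; simp only [pow_succ, pow_zero, one_mul, mul_assoc]
      _ = b * a * c * a * d * a := by rw [h₂]; simp only [mul_assoc]
  · calc a * b * c * a * d * b = a * (b * c) * a * d * b := by simp only [mul_assoc]
      _ = a ^ 2 * b * c * d * b := by rw [← h₂]; simp only [mul_assoc]
      _ = b * (a ^ 2 * c) * d * b := by rw [← h₄]; simp only [mul_assoc]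
      _ = b * a * c * a * d * b := by rw [h₂]; simp only [mul_assoc]
  · calc a * c * a * b * d * b = a ^ 2 * c * b * d * b := by rw [h₂]
      _ = a ^ 2 * (c * b) * d * b := by simp only [mul_assoc]
      _ = a * c * b * a * d * b := by rw [h₂]; simp only [mul_assoc]
  · calc a * d * b * c * a * b = a * d * (b * (c * a) * b) := by simp only [mul_assoc]
      _ = a * d * (b ^ 2 * c * a) := by rw [← h₂]; simp only [mul_assoc]
      _ = a * d * b * c * b * a := by rw [h₂]; simp only [mul_assoc]

theorem coe_pow (c : Con F) (u : F) (n : ℕ) : ((u ^ n : F) : c.Quotient) = (u : c.Quotient) ^ n :=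
  rfl

theorem sigmaRR_le_of_identities {c : FICon}
    (h : ∀ X Y Z T : c.1.Quotient,
      X ^ 4 = X ^ 3 ∧ X ^ 3 * Y * Z * T = Y * X * Z * X * T * X ∧
      X * Y * Z * X * T * Y = Y * X * Z * X * T * Y ∧
      X * Z * X * Y * T * Y = X * Z * Y * X * T * Y ∧
      X * T * Y * Z * X * Y = X * T * Y * Z * Y * X) : sigmaRR ≤ c := by
  have h := h (x : F) (y : F) (z : F) (t : F)
  simp only [← Con.coe_mul, ← coe_pow, Con.eq] at h
  refine fic_le_iff.2 ?_
  simpa only [Set.mem_insert_iff, Set.mem_singleton_iff, forall_eq_or_imp, forall_eq] using h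

theorem sigmaD_gens : sigmaD.1 (x ^ 3) (x ^ 2) ∧ sigmaD.1 (x ^ 2 * y) (x * y * x) ∧
    sigmaD.1 (x * y * x) (y * x ^ 2) := by
  have h := fic_le_iff.1 (le_refl sigmaD : fic _ ≤ sigmaD)
  simpa only [Set.mem_insert_iff, Set.mem_singleton_iff, forall_eq_or_imp, forall_eq] using h

theorem sigmaC3_gens : sigmaC3.1 (x ^ 4) (x ^ 3) ∧ sigmaC3.1 (x * y) (y * x) := by
  have h := fic_le_iff.1 (le_refl sigmaC3 : fic _ ≤ sigmaC3)
  simpa only [Set.mem_insert_iff, Set.mem_singleton_iff, forall_eq_or_imp, forall_eq] using h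

theorem quotient_eq {c : FICon} {u v : F} (h : c.1 u v) (X Y : F) :
    ((subst X Y 1 1 u : F) : c.1.Quotient) = (subst X Y 1 1 v : F) :=
  c.1.eq.2 (c.2 _ _ _ h)

theorem sigmaRR_le_sigmaD : sigmaRR ≤ sigmaD := by
  obtain ⟨h₁, h₂, h₃⟩ := sigmaD_gens
  refine sigmaRR_le_of_identities (identities_of_sq (fun a => ?_) (fun a b => ?_) fun a b => ?_)
  · induction a using Con.induction_on with | _ X
    simpa only [map_pow, subst_x, coe_pow] using quotient_eq h₁ X 1
  · induction a, b using Con.induction_on₂ with | _ X Y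
    simpa only [map_mul, map_pow, subst_x, subst_y, Con.coe_mul, coe_pow] using
      quotient_eq h₂ X Y
  · induction a, b using Con.induction_on₂ with | _ X Y
    simpa only [map_mul, map_pow, subst_x, subst_y, Con.coe_mul, coe_pow] using
      quotient_eq h₃ X Y

theorem sigmaC3_comm (X Y : sigmaC3.1.Quotient) : X * Y = Y * X := by
  induction X, Y using Con.induction_on₂ with | _ X Y
  simpa only [map_mul, subst_x, subst_y, Con.coe_mul] using quotient_eq sigmaC3_gens.2 X Y

theorem sigmaRR_le_sigmaC3 : sigmaRR ≤ sigmaC3 := by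
  let _ : CommMonoid sigmaC3.1.Quotient := { mul_comm := sigmaC3_comm }
  refine sigmaRR_le_of_identities fun X Y Z T => ⟨?_, ?_, ?_, ?_, ?_⟩
  · induction X using Con.induction_on with | _ X
    simpa only [map_pow, subst_x, coe_pow] using quotient_eq sigmaC3_gens.1 X 1
  · rw [pow_three]; ac_rfl
  all_goals ac_rfl

theorem fic_singleton_le_sigmaC3 {u v : F}
    (h : (u : sigmaC3.1.Quotient) = v) : fic {(u, v)} ≤ sigmaC3 :=
  fic_le_iff.2 (by rintro _ rfl; exact sigmaC3.1.eq.1 h)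

theorem sigmaR_le : sigmaR ≤ sigmaD ⊓ sigmaC3 := by
  refine sup_le (le_inf sigmaRR_le_sigmaD sigmaRR_le_sigmaC3) (le_inf ?_ ?_)
  · exact fic_le_iff.2 (by rintro _ rfl; exact sigmaD_gens.2.2)
  · refine fic_singleton_le_sigmaC3 ?_
    simp only [Con.coe_mul, pow_two]
    rw [sigmaC3_comm x y, mul_assoc]

theorem sigmaRdelta_le : sigmaRdelta ≤ sigmaD ⊓ sigmaC3 := by
  refine sup_le (le_inf sigmaRR_le_sigmaD sigmaRR_le_sigmaC3) (le_inf ?_ ?_)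
  · exact fic_le_iff.2 (by rintro _ rfl; exact sigmaD.1.symm sigmaD_gens.2.1)
  · refine fic_singleton_le_sigmaC3 ?_
    simp only [Con.coe_mul, pow_two]
    rw [mul_assoc, sigmaC3_comm y x, mul_assoc]

theorem sigmaDC_le : sigmaDC ≤ sigmaD ⊓ sigmaC3 := by
  refine sup_le (le_inf sigmaRR_le_sigmaD sigmaRR_le_sigmaC3) (le_inf ?_ ?_)
  · exact fic_le_iff.2 (by rintro _ rfl; exact sigmaD.1.trans sigmaD_gens.2.1 sigmaD_gens.2.2)
  · refine fic_singleton_le_sigmaC3 ?_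
    simp only [Con.coe_mul]
    rw [sigmaC3_comm]

theorem sigmaR_rel : sigmaR.1 (x * y * x) (y * x ^ 2) :=
  fic_le_iff.1 (le_sup_right : fic {(x * y * x, y * x ^ 2)} ≤ sigmaR) _ rfl

theorem sigmaRdelta_rel : sigmaRdelta.1 (x * y * x) (x ^ 2 * y) :=
  fic_le_iff.1 (le_sup_right : fic {(x * y * x, x ^ 2 * y)} ≤ sigmaRdelta) _ rfl

theorem sigmaDC_rel : sigmaDC.1 (x ^ 2 * y) (y * x ^ 2) :=
  fic_le_iff.1 (le_sup_right : fic {(x ^ 2 * y, y * x ^ 2)} ≤ sigmaDC) _ rfl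

theorem sigmaR_inf_sigmaRdelta : sigmaR ⊓ sigmaRdelta = sigmaRR := by
  refine le_antisymm (le_sigmaRR (inf_le_left.trans sigmaR_le) fun a b u v hab h hu hv => ?_)
    (le_inf le_sup_left le_sup_left)
  have h₁ := filter_iff_of_synCon (inf_le_left.trans (sigmaR_le_synCon hab) h) a b
  have h₂ := filter_iff_of_synCon (inf_le_right.trans (sigmaRdelta_le_synCon hab) h) a b
  have hu := eq_of_perm_triple hab hu
  have hv := eq_of_perm_triple hab hv
  grind

theorem sigmaR_inf_sigmaDC : sigmaR ⊓ sigmaDC = sigmaRR := by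
  refine le_antisymm (le_sigmaRR (inf_le_left.trans sigmaR_le) fun a b u v hab h hu hv => ?_)
    (le_inf le_sup_left le_sup_left)
  have h₁ := filter_iff_of_synCon (inf_le_left.trans (sigmaR_le_synCon hab) h) a b
  have h₂ := filter_iff_of_synCon (inf_le_right.trans (sigmaDC_le_synCon hab) h) a b
  have hu := eq_of_perm_triple hab hu
  have hv := eq_of_perm_triple hab hv
  grind

theorem sigmaRdelta_inf_sigmaDC : sigmaRdelta ⊓ sigmaDC = sigmaRR := by
  refine le_antisymm
    (le_sigmaRR (inf_le_left.trans sigmaRdelta_le) fun a b u v hab h hu hv => ?_)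
    (le_inf le_sup_left le_sup_left)
  have h₁ := filter_iff_of_synCon (inf_le_left.trans (sigmaRdelta_le_synCon hab) h) a b
  have h₂ := filter_iff_of_synCon (inf_le_right.trans (sigmaDC_le_synCon hab) h) a b
  have hu := eq_of_perm_triple hab hu
  have hv := eq_of_perm_triple hab hv
  grind

theorem sigmaR_sup_sigmaRdelta : sigmaR ⊔ sigmaRdelta = sigmaD ⊓ sigmaC3 :=
  le_antisymm (sup_le sigmaR_le sigmaRdelta_le)
    (sigmaD_inf_sigmaC3_le (le_sup_left.trans le_sup_left)
      ((le_sup_right : sigmaRdelta ≤ sigmaR ⊔ sigmaRdelta) sigmaRdelta_rel)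
      ((le_sup_left : sigmaR ≤ sigmaR ⊔ sigmaRdelta) sigmaR_rel))

theorem sigmaR_sup_sigmaDC : sigmaR ⊔ sigmaDC = sigmaD ⊓ sigmaC3 := by
  have h₁ := (le_sup_left : sigmaR ≤ sigmaR ⊔ sigmaDC) sigmaR_rel
  have h₂ := (le_sup_right : sigmaDC ≤ sigmaR ⊔ sigmaDC) sigmaDC_rel
  exact le_antisymm (sup_le sigmaR_le sigmaDC_le)
    (sigmaD_inf_sigmaC3_le (le_sup_left.trans le_sup_left)
      (Con.trans _ h₁ (Con.symm _ h₂)) h₁)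

theorem sigmaRdelta_sup_sigmaDC : sigmaRdelta ⊔ sigmaDC = sigmaD ⊓ sigmaC3 := by
  have h₁ := (le_sup_left : sigmaRdelta ≤ sigmaRdelta ⊔ sigmaDC) sigmaRdelta_rel
  have h₂ := (le_sup_right : sigmaDC ≤ sigmaRdelta ⊔ sigmaDC) sigmaDC_rel
  exact le_antisymm (sup_le sigmaRdelta_le sigmaDC_le)
    (sigmaD_inf_sigmaC3_le (le_sup_left.trans le_sup_left) h₁ (Con.trans _ h₁ h₂))

theorem sigmaR_ne_sigmaRdelta : sigmaR ≠ sigmaRdelta := by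
  intro h
  have := sigmaR_le_synCon (a := 0) (b := 1) (by norm_num)
    (h ▸ sigmaRdelta_rel : sigmaR.1 (x * y * x) (x ^ 2 * y)) (MonoidHom.id F) 1 1
  revert this
  change ¬ ([0, 1, 0] = [0, 0, 1] ↔ [0, 0, 1] = [0, 0, 1])
  decide

theorem sigmaR_ne_sigmaDC : sigmaR ≠ sigmaDC := by
  intro h
  have := sigmaR_le_synCon (a := 0) (b := 1) (by norm_num)
    (h ▸ sigmaDC_rel : sigmaR.1 (x ^ 2 * y) (y * x ^ 2)) (MonoidHom.id F) 1 1
  revert this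
  change ¬ ([0, 0, 1] = [0, 0, 1] ↔ [1, 0, 0] = [0, 0, 1])
  decide

theorem sigmaRdelta_ne_sigmaDC : sigmaRdelta ≠ sigmaDC := by
  intro h
  have := sigmaRdelta_le_synCon (a := 0) (b := 1) (by norm_num)
    (h ▸ sigmaDC_rel : sigmaRdelta.1 (x ^ 2 * y) (y * x ^ 2)) (MonoidHom.id F) 1 1
  revert this
  change ¬ ([0, 0, 1] = [1, 0, 0] ↔ [1, 0, 0] = [1, 0, 0])
  decide

/-- The elements `σ_R`, `σ_Rδ`, `σ_DC` of the lattice of fully invariant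
congruences on `F` are pairwise distinct, any two of them meet in `σ_RRδ` and
any two of them join to `σ_D ⊓ σ_C3`; consequently the five elements
`σ_RRδ, σ_R, σ_Rδ, σ_DC, σ_D ⊓ σ_C3` form a diamond `M₃`, and so the interval
`[σ_RRδ, ⊤]` is not distributive. -/
theorem diamond_in_interval :
    sigmaR ≠ sigmaRdelta ∧ sigmaR ≠ sigmaDC ∧ sigmaRdelta ≠ sigmaDC ∧
      sigmaR ⊓ sigmaRdelta = sigmaRR ∧ sigmaR ⊓ sigmaDC = sigmaRR ∧
      sigmaRdelta ⊓ sigmaDC = sigmaRR ∧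
      sigmaR ⊔ sigmaRdelta = sigmaD ⊓ sigmaC3 ∧
      sigmaR ⊔ sigmaDC = sigmaD ⊓ sigmaC3 ∧
      sigmaRdelta ⊔ sigmaDC = sigmaD ⊓ sigmaC3 ∧
      ¬ (∀ a b c : Set.Icc sigmaRR (⊤ : FICon), a ⊓ (b ⊔ c) ≤ (a ⊓ b) ⊔ (a ⊓ c)) := by
  refine ⟨sigmaR_ne_sigmaRdelta, sigmaR_ne_sigmaDC, sigmaRdelta_ne_sigmaDC,
    sigmaR_inf_sigmaRdelta, sigmaR_inf_sigmaDC, sigmaRdelta_inf_sigmaDC,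
    sigmaR_sup_sigmaRdelta, sigmaR_sup_sigmaDC, sigmaRdelta_sup_sigmaDC, fun h => ?_⟩
  have h : sigmaR ⊓ (sigmaRdelta ⊔ sigmaDC) ≤ (sigmaR ⊓ sigmaRdelta) ⊔ (sigmaR ⊓ sigmaDC) :=
    h ⟨sigmaR, le_sup_left, le_top⟩ ⟨sigmaRdelta, le_sup_left, le_top⟩
      ⟨sigmaDC, le_sup_left, le_top⟩
  rw [sigmaRdelta_sup_sigmaDC, inf_eq_left.2 sigmaR_le, sigmaR_inf_sigmaRdelta,
    sigmaR_inf_sigmaDC, sup_idem] at h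
  refine sigmaRdelta_ne_sigmaDC ?_
  rw [← sup_eq_right.2 (h.trans le_sup_left : sigmaR ≤ sigmaRdelta), sigmaR_sup_sigmaRdelta,
    ← sigmaR_sup_sigmaDC, sup_eq_right.2 (h.trans le_sup_left : sigmaR ≤ sigmaDC)]
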